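/- In the 3d-player Zeckendorf game with two alliances, where the small alliance consists of d consecutive players and the big alliance consists of the remaining 2d consecutive players, if n ≥ 12d² + 4d then the big alliance has a winning strategy. -/

import Mathlib

/-- Fibonacci numbers indexed so that `zF 1 = 1`, `zF 2 = 2`,
`zF (i+1) = zF i + zF (i-1)`. -/
def zF (n : ℕ) : ℕ := Nat.fib (n + 1)

/-- The starting state of the Zeckendorf game on `n`: `n` copies of `F 1 = 1`.
States are multisets of indices `i`, the index `i` standing for `F i`. -/
def zstart (n : ℕ) : Multiset ℕ := Multiset.replicate n 1

/-- Legal moves of the Zeckendorf game, on multisets of indices. -/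
inductive ZMove : Multiset ℕ → Multiset ℕ → Prop
  | combine (i : ℕ) (M : Multiset ℕ) (hi : 2 ≤ i) :
      ZMove ({i - 1, i} + M) ({i + 1} + M)
  | combine1 (M : Multiset ℕ) : ZMove ({1, 1} + M) ({2} + M)
  | split2 (M : Multiset ℕ) : ZMove ({2, 2} + M) ({1, 3} + M)
  | split (i : ℕ) (M : Multiset ℕ) (hi : 3 ≤ i) :
      ZMove ({i, i} + M) ({i - 2, i + 1} + M)

/-- `ZWins p S t M` : in the `p`-player Zeckendorf game where move number `t`
(counting from 0) is made by player `t % p`, the coalition `S` of players has a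
strategy from state `M` at turn `t` guaranteeing that a member of `S` makes the
final move (the move producing a state with no legal moves). -/
inductive ZWins (p : ℕ) (S : Set ℕ) : ℕ → Multiset ℕ → Prop
  | mine_end (t : ℕ) (M M' : Multiset ℕ) (hS : t % p ∈ S) (hmv : ZMove M M')
      (h : ∀ N, ¬ ZMove M' N) : ZWins p S t M
  | mine_step (t : ℕ) (M M' : Multiset ℕ) (hS : t % p ∈ S) (hmv : ZMove M M')
      (h : ZWins p S (t + 1) M') : ZWins p S t M
  | theirs (t : ℕ) (M : Multiset ℕ) (hS : t % p ∉ S) (hne : ∃ M', ZMove M M')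
      (h : ∀ M', ZMove M M' → ZWins p S (t + 1) M') : ZWins p S t M

/-- The specific move `1 + 1 = 2`. -/
def MOneOne (M M' : Multiset ℕ) : Prop :=
  ({1, 1} : Multiset ℕ) ≤ M ∧ M' = M - {1, 1} + {2}

/-- The specific move `1 + 2 = 3`. -/
def MOneTwo (M M' : Multiset ℕ) : Prop :=
  ({1, 2} : Multiset ℕ) ≤ M ∧ M' = M - {1, 2} + {3}

/-- The specific move `2 + 2 = 1 + 3`. -/
def MTwoTwo (M M' : Multiset ℕ) : Prop :=
  ({2, 2} : Multiset ℕ) ≤ M ∧ M' = M - {2, 2} + {1, 3}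

/-- The weight of an index: an additive potential that every move decreases. -/
def zWeight (i : ℕ) : ℕ := if i = 1 then 3 else i + 3

/-- The total weight of a state. -/
def zPotential (M : Multiset ℕ) : ℕ := (M.map zWeight).sum

theorem ZMove.zPotential_lt {M M' : Multiset ℕ} (h : ZMove M M') :
    zPotential M' < zPotential M := by
  cases h with
  | combine i R hi =>
    simp only [zPotential, zWeight, Multiset.insert_eq_cons, Multiset.map_add, Multiset.map_cons,
      Multiset.map_singleton, Multiset.sum_add, Multiset.sum_cons, Multiset.sum_singleton]
    split_ifs <;> omega
  | combine1 R => simp [zPotential, zWeight]; omega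
  | split2 R => simp [zPotential, zWeight]; omega
  | split i R hi =>
    simp only [zPotential, zWeight, Multiset.insert_eq_cons, Multiset.map_add, Multiset.map_cons,
      Multiset.map_singleton, Multiset.sum_add, Multiset.sum_cons, Multiset.sum_singleton]
    split_ifs <;> omega

theorem ZMove.count_one_le {M M' : Multiset ℕ} (h : ZMove M M') :
    M.count 1 ≤ M'.count 1 + 2 := by
  cases h <;>
    simp only [Multiset.insert_eq_cons, Multiset.count_add, Multiset.count_cons,
      Multiset.count_singleton] <;> split_ifs <;> omega

/-- Only the move `2 + 2 = 1 + 3` removes two copies of the index `2`. -/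
theorem ZMove.count_two_le {M M' : Multiset ℕ} (h : ZMove M M') :
    M.count 2 ≤ M'.count 2 + 1 ∨
      M.count 2 = M'.count 2 + 2 ∧ M + {1, 3} = M' + {2, 2} := by
  cases h with
  | split2 R =>
    right
    refine ⟨by simp, by abel⟩
  | combine i R hi =>
    left
    simp only [Multiset.insert_eq_cons, Multiset.count_add, Multiset.count_cons,
      Multiset.count_singleton]
    split_ifs <;> omega
  | combine1 R => left; simp; omega
  | split i R hi =>
    left
    simp only [Multiset.insert_eq_cons, Multiset.count_add, Multiset.count_cons,
      Multiset.count_singleton]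
    split_ifs <;> omega

theorem exists_eq_nsmul_add {a k : ℕ} {M : Multiset ℕ} (h : k ≤ M.count a) :
    ∃ R, M = k • {a} + R := by
  obtain ⟨R, hR⟩ := Multiset.le_iff_exists_add.mp (Multiset.le_count_iff_replicate_le.mp h)
  exact ⟨R, by rw [hR, Multiset.nsmul_singleton]⟩

theorem exists_zMove_of_two_le_count_one {M : Multiset ℕ} (h : 2 ≤ M.count 1) :
    ∃ M', ZMove M M' := by
  obtain ⟨R, rfl⟩ := exists_eq_nsmul_add h
  exact ⟨_, ZMove.combine1 R⟩

/-- Strategy stealing: a coalition whose turns, delayed by `k`, contain those of a winning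
coalition wins the same position `k` moves later. -/
theorem ZWins.shift {p t k : ℕ} {S T : Set ℕ} {M : Multiset ℕ} (h : ZWins p T t M)
    (hk : ∀ u, u % p ∈ T → (u + k) % p ∈ S) : ZWins p S (t + k) M := by
  induction h with
  | mine_end u M M' hT hmv hend => exact .mine_end _ M M' (hk u hT) hmv hend
  | mine_step u M M' hT hmv _ ih =>
    exact .mine_step _ M M' (hk u hT) hmv (by rwa [Nat.add_right_comm])
  | theirs u M hT hne _ ih =>
    by_cases hS : (u + k) % p ∈ S
    · obtain ⟨M', hmv⟩ := hne
      exact .mine_step _ M M' hS hmv (by rw [Nat.add_right_comm]; exact ih M' hmv)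
    · exact .theirs _ M hS hne fun M' hmv => by rw [Nat.add_right_comm]; exact ih M' hmv

/-- The game is determined. -/
theorem ZWins.or_compl (p : ℕ) (S : Set ℕ) (t : ℕ) (M : Multiset ℕ) (hM : ∃ M', ZMove M M') :
    ZWins p S t M ∨ ZWins p Sᶜ t M := by
  induction hm : zPotential M using Nat.strong_induction_on generalizing t M with
  | _ m ih =>
    subst hm
    wlog hS : t % p ∈ S generalizing S
    · have := this Sᶜ (fun _ hlt t' N hN hm => by
        rw [compl_compl]; exact (ih _ hlt t' N hN hm).symm) hS
      rw [compl_compl] at this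
      exact this.symm
    by_cases hwin : ZWins p S t M
    · exact .inl hwin
    refine .inr (.theirs t M (fun h => h hS) hM fun M' hmv => ?_)
    have hM' : ∃ N, ZMove M' N := by
      by_contra! hend
      exact hwin (.mine_end t M M' hS hmv hend)
    exact (ih _ hmv.zPotential_lt (t + 1) M' hM' rfl).resolve_left
      fun h => hwin (.mine_step t M M' hS hmv h)

/-- Two positions that differ only by a delay after which the coalition has all the turns that
its opponents had cannot both be lost. -/
theorem zWins_or_zWins_add {p k : ℕ} {S : Set ℕ} (hk : ∀ u, u % p ∉ S → (u + k) % p ∈ S)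
    (t : ℕ) {M : Multiset ℕ} (hM : ∃ M', ZMove M M') :
    ZWins p S t M ∨ ZWins p S (t + k) M :=
  (ZWins.or_compl p S t M hM).imp_right fun h => h.shift hk

/-- From a position it does not win, a coalition can repeat a move, staying in such positions. -/
theorem not_zWins_repeat {p t : ℕ} {S : Set ℕ} {A B R : Multiset ℕ}
    (hAB : ∀ R, ZMove (A + R) (B + R)) (k : ℕ) (hS : ∀ j < k, (t + j) % p ∈ S)
    (h : ¬ ZWins p S t (k • A + R)) : ¬ ZWins p S (t + k) (k • B + R) := by
  induction k generalizing R with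
  | zero => simpa using h
  | succ k ih =>
    have h' : ¬ ZWins p S (t + k) (A + (k • B + R)) := by
      rw [← add_assoc, add_comm A, add_assoc]
      refine ih (fun j hj => hS j (by omega)) ?_
      rwa [← add_assoc, ← succ_nsmul]
    intro hw
    refine h' (.mine_step _ _ _ (hS k (by omega)) (hAB _) ?_)
    rwa [← add_assoc, add_comm B, ← succ_nsmul]

theorem exists_not_zWins_succ {p t : ℕ} {S : Set ℕ} {M : Multiset ℕ} (hM : ∃ M', ZMove M M')
    (h : ¬ ZWins p S t M) : ∃ M', ZMove M M' ∧ ¬ ZWins p S (t + 1) M' := by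
  by_cases hS : t % p ∈ S
  · obtain ⟨M', hmv⟩ := hM
    exact ⟨M', hmv, fun hw => h (.mine_step t M M' hS hmv hw)⟩
  · by_contra! hc
    exact h (.theirs t M hS hM hc)

/-- After any `k` moves at most `2 * k` copies of `2` have disappeared, with equality only if all
these moves are `2 + 2 = 1 + 3`. -/
theorem exists_not_zWins_add {p t : ℕ} {S : Set ℕ} {M : Multiset ℕ} (k : ℕ)
    (hM : 2 * k ≤ M.count 1) (h : ¬ ZWins p S t M) :
    ∃ M', ¬ ZWins p S (t + k) M' ∧ M.count 1 ≤ M'.count 1 + 2 * k ∧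
      (M.count 2 + 1 ≤ M'.count 2 + 2 * k ∨
        M.count 2 = M'.count 2 + 2 * k ∧ M + k • {1, 3} = M' + k • {2, 2}) := by
  induction k with
  | zero => exact ⟨M, h, by simp, by simp⟩
  | succ k ih =>
    obtain ⟨N, hN, h1, h2⟩ := ih (by omega)
    obtain ⟨N', hmv, hN'⟩ :=
      exists_not_zWins_succ (exists_zMove_of_two_le_count_one (by omega)) hN
    have h1' := hmv.count_one_le
    refine ⟨N', hN', by omega, ?_⟩
    rcases h2 with h2 | ⟨h2, hk⟩ <;> rcases hmv.count_two_le with h3 | ⟨h3, hk'⟩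
    · left; omega
    · left; omega
    · left; omega
    · right
      refine ⟨by omega, ?_⟩
      rw [succ_nsmul, ← add_assoc, hk, add_right_comm, hk', succ_nsmul]
      abel

/-- If the coalition has the next `2 * d` moves, with `d` copies of `2` at hand, then it wins: it
can reach one and the same state in `d` or in `2 * d` moves. -/
theorem zWins_of_le_count_two {p d t : ℕ} {S : Set ℕ} {M : Multiset ℕ} (hd : 0 < d)
    (hk : ∀ u, u % p ∉ S → (u + d) % p ∈ S) (hS : ∀ j < 2 * d, (t + j) % p ∈ S)
    (h1 : 4 * d ≤ M.count 1) (h2 : d ≤ M.count 2) : ZWins p S t M := by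
  by_contra h
  obtain ⟨R, rfl⟩ := exists_eq_nsmul_add h2
  obtain ⟨R, rfl⟩ := exists_eq_nsmul_add (a := 1) (k := 2 * d) (M := R) (by
    simp at h1; omega)
  have hx : ¬ ZWins p S (t + d) (d • {3} + (d • {1} + R)) := by
    refine not_zWins_repeat (A := {1, 2}) (fun R => .combine 2 R le_rfl) d
      (fun j hj => hS j (by omega)) fun hw => h ?_
    convert hw using 1
    rw [Multiset.insert_eq_cons, ← Multiset.singleton_add, nsmul_add, two_mul, add_nsmul]
    abel
  have hy : ¬ ZWins p S (t + d) (d • {2} + (d • {2} + R)) := by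
    refine not_zWins_repeat (A := {1, 1}) (fun R => .combine1 R) d
      (fun j hj => hS j (by omega)) fun hw => h ?_
    convert hw using 1
    rw [Multiset.insert_eq_cons, ← Multiset.singleton_add, nsmul_add, two_mul, add_nsmul]
    abel
  have hz : ¬ ZWins p S (t + d + d) (d • {1, 3} + R) := by
    refine not_zWins_repeat (A := {2, 2}) (fun R => .split2 R) d
      (fun j hj => by rw [add_assoc]; exact hS _ (by omega)) fun hw => hy ?_
    convert hw using 1
    rw [Multiset.insert_eq_cons, ← Multiset.singleton_add, nsmul_add]
    abel
  have hxz : d • ({3} : Multiset ℕ) + (d • {1} + R) = d • {1, 3} + R := by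
    rw [Multiset.insert_eq_cons, ← Multiset.singleton_add, nsmul_add]
    abel
  rw [hxz] at hx
  refine (zWins_or_zWins_add hk (t + d) (exists_zMove_of_two_le_count_one ?_)).elim hx hz
  simp [Multiset.count_nsmul] at h1 ⊢
  omega

/-- If a coalition about to make `2 * d` moves does not win, then it can gain a copy of `2` within
`3 * d` moves: otherwise its opponents answer `1 + 1 = 2` with `2 + 2 = 1 + 3` only, and the state
they reach was reachable `d` moves earlier. -/
theorem exists_not_zWins_count_two_lt {p d t : ℕ} {S : Set ℕ} {M : Multiset ℕ} (hd : 0 < d)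
    (hk : ∀ u, u % p ∉ S → (u + d) % p ∈ S) (hS : ∀ j < 2 * d, (t + j) % p ∈ S)
    (h1 : 8 * d ≤ M.count 1) (h : ¬ ZWins p S t M) :
    ∃ M', ¬ ZWins p S (t + 3 * d) M' ∧ M.count 1 ≤ M'.count 1 + 6 * d ∧
      M.count 2 < M'.count 2 := by
  obtain ⟨R, rfl⟩ := exists_eq_nsmul_add (a := 1) (k := 4 * d) (M := M) (by omega)
  have hR : 4 * d ≤ R.count 1 := by
    simp [Multiset.count_nsmul] at h1; omega
  have e4 : (4 * d) • ({1} : Multiset ℕ) = d • {1} + d • {1} + d • {1} + d • {1} := by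
    rw [← add_nsmul, ← add_nsmul, ← add_nsmul]; congr 1; omega
  have hx : ¬ ZWins p S (t + 2 * d) ((2 * d) • {2} + R) := by
    refine not_zWins_repeat (A := {1, 1}) (fun R => .combine1 R) (2 * d) hS fun hw => h ?_
    convert hw using 1
    rw [Multiset.insert_eq_cons, ← Multiset.singleton_add, nsmul_add, e4, two_mul, add_nsmul]
    abel
  obtain ⟨N, hN, hN1, hN2⟩ := exists_not_zWins_add d (by
    simp; omega) hx
  simp only [Multiset.count_add, Multiset.count_nsmul, Multiset.count_singleton] at hN1 hN2 ⊢
  norm_num only [if_true, if_false, mul_one, mul_zero, zero_add] at hN1 hN2 ⊢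
  have ht : t + 2 * d + d = t + 3 * d := by omega
  rw [ht] at hN
  rcases hN2 with hN2 | ⟨-, hN2⟩
  · exact ⟨N, hN, by omega, by omega⟩
  exfalso
  have hNR : N = d • {1, 3} + R := by
    rw [Multiset.insert_eq_cons 2, ← Multiset.singleton_add, nsmul_add, two_mul, add_nsmul] at hN2
    refine add_right_cancel (b := d • {2} + d • {2}) ?_
    rw [← hN2]
    abel
  have hy : ¬ ZWins p S (t + d) (d • {2} + (d • {1} + d • {1} + R)) := by
    refine not_zWins_repeat (A := {1, 1}) (fun R => .combine1 R) d
      (fun j hj => hS j (by omega)) fun hw => h ?_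
    convert hw using 1
    rw [Multiset.insert_eq_cons, ← Multiset.singleton_add, nsmul_add, e4]
    abel
  have hz : ¬ ZWins p S (t + d + d) (d • {3} + (d • {1} + R)) := by
    refine not_zWins_repeat (A := {1, 2}) (fun R => .combine 2 R le_rfl) d
      (fun j hj => by rw [add_assoc]; exact hS _ (by omega)) fun hw => hy ?_
    convert hw using 1
    rw [Multiset.insert_eq_cons, ← Multiset.singleton_add, nsmul_add]
    abel
  have hzN : d • ({3} : Multiset ℕ) + (d • {1} + R) = N := by
    rw [hNR, Multiset.insert_eq_cons, ← Multiset.singleton_add, nsmul_add]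
    abel
  rw [hzN] at hz
  refine (zWins_or_zWins_add hk (t + d + d)
    (exists_zMove_of_two_le_count_one (M := N) (by omega))).elim hz ?_
  rwa [show t + d + d + d = t + 3 * d by omega]

/-- In the `3d`-player Zeckendorf game whose big alliance consists of the `2d`
consecutive players `s, s+1, …, s+2d-1 (mod 3d)` (the small alliance being the
remaining `d` consecutive players), if `n ≥ 12d² + 4d` then the big alliance
has a winning strategy. -/
theorem stmt_16 (d n s : ℕ) (hd : 0 < d) (hn : 12 * d ^ 2 + 4 * d ≤ n) :
    ZWins (3 * d) {i | ∃ k < 2 * d, i % (3 * d) = (s + k) % (3 * d)} 0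
      (zstart n) := by
  set S : Set ℕ := {i | ∃ k < 2 * d, i % (3 * d) = (s + k) % (3 * d)} with hS
  have hturn : ∀ m, ∀ j < 2 * d, (s % (3 * d) + m * (3 * d) + j) % (3 * d) ∈ S := by
    intro m j hj
    refine ⟨j, hj, ?_⟩
    rw [Nat.mod_mod, add_right_comm, Nat.add_mul_mod_self_right, Nat.mod_add_mod]
  have hk : ∀ u, u % (3 * d) ∉ S → (u + d) % (3 * d) ∈ S := by
    intro u hu
    obtain ⟨k, hk, huk⟩ : ∃ k < 3 * d, u ≡ s + k [MOD 3 * d] := by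
      refine ⟨(u + (3 * d - s % (3 * d))) % (3 * d), Nat.mod_lt _ (by omega), ?_⟩
      have hs : s % (3 * d) < 3 * d := Nat.mod_lt _ (by omega)
      have h : s % (3 * d) + (u + (3 * d - s % (3 * d))) = u + 3 * d := by omega
      rw [Nat.ModEq, Nat.add_mod_mod, ← Nat.mod_add_mod, h, Nat.add_mod_right]
    have h2 : 2 * d ≤ k := by
      by_contra! hlt
      exact hu ⟨k, hlt, by rw [Nat.mod_mod]; exact huk⟩
    refine ⟨k - 2 * d, by omega, ?_⟩
    have h : s + k + d = s + (k - 2 * d) + 3 * d := by omega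
    rw [Nat.mod_mod, (huk.add_right d : (u + d) % (3 * d) = _), h, Nat.add_mod_right]
  have hd2 : d ≤ d ^ 2 := Nat.le_self_pow two_ne_zero d
  by_contra h
  have hs : s % (3 * d) < 3 * d := Nat.mod_lt _ (by omega)
  have hrounds : ∀ m ≤ d, ∃ M, ¬ ZWins (3 * d) S (s % (3 * d) + m * (3 * d)) M ∧
      n ≤ M.count 1 + 6 * d + m * (6 * d) ∧ m ≤ M.count 2 := by
    intro m
    induction m with
    | zero =>
      intro _
      have hc : (zstart n).count 1 = n := Multiset.count_replicate_self 1 n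
      obtain ⟨M, hM, hM1, -⟩ := exists_not_zWins_add (s % (3 * d)) (by omega) h
      exact ⟨M, by simpa using hM, by omega, Nat.zero_le _⟩
    | succ m ih =>
      intro hm
      obtain ⟨M, hM, hM1, hM2⟩ := ih (by omega)
      have hmd : (m + 1) * (6 * d) ≤ 6 * d ^ 2 := by nlinarith
      rw [add_mul, one_mul] at hmd
      obtain ⟨M', hM', hM1', hM2'⟩ :=
        exists_not_zWins_count_two_lt hd hk (hturn m) (by omega) hM
      refine ⟨M', ?_, ?_, by omega⟩
      · rwa [add_mul, one_mul, ← add_assoc]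
      · rw [add_mul, one_mul]; omega
  obtain ⟨M, hM, hM1, hM2⟩ := hrounds d le_rfl
  have hmd : d * (6 * d) = 6 * d ^ 2 := by ring
  exact hM (zWins_of_le_count_two hd hk (hturn d) (by omega) hM2)
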